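/- The polynomial g₁(x, 6, 3) = Σ_{j=0}^{6} (6!/j!)·C(9−j, 6−j)·x^j is irreducible over ℚ. -/

import Mathlib

open Polynomial Finset

/-- If a product of monic integer polynomials is divisible by `X ^ k` modulo a prime `p`, and its
constant term is not divisible by `p ^ 2`, then one of the two factors has degree at least `k`. -/
theorem le_natDegree_or_of_X_pow_dvd_map {p : ℕ} [Fact p.Prime] {g h : ℤ[X]} (hg : g.Monic)
    (hh : h.Monic) {k : ℕ} (hk : X ^ k ∣ (g * h).map (Int.castRingHom (ZMod p)))
    (h0 : ¬ (p : ℤ) ^ 2 ∣ (g * h).coeff 0) : k ≤ g.natDegree ∨ k ≤ h.natDegree := by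
  have key {q : ℤ[X]} (hq : q.Monic) (hd : X ^ k ∣ q.map (Int.castRingHom (ZMod p))) :
      k ≤ q.natDegree := by
    simpa [hq.natDegree_map] using natDegree_le_of_dvd hd (hq.map _).ne_zero
  rw [Polynomial.map_mul] at hk
  by_cases h1 : X ∣ g.map (Int.castRingHom (ZMod p))
  · by_cases h2 : X ∣ h.map (Int.castRingHom (ZMod p))
    · rw [X_dvd_iff, coeff_map, eq_intCast, ZMod.intCast_zmod_eq_zero_iff_dvd] at h1 h2
      rw [mul_coeff_zero, sq] at h0
      exact absurd (mul_dvd_mul h1 h2) h0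
    · exact .inl (key hg (prime_X.pow_dvd_of_dvd_mul_right k h2 hk))
  · exact .inr (key hh (prime_X.pow_dvd_of_dvd_mul_left k h1 hk))

theorem monic_sextic : (X ^ 6 + 24 * X ^ 5 + 300 * X ^ 4 + 2400 * X ^ 3 + 12600 * X ^ 2 +
    40320 * X + 60480 : ℤ[X]).Monic := by
  monicity!

theorem natDegree_sextic : (X ^ 6 + 24 * X ^ 5 + 300 * X ^ 4 + 2400 * X ^ 3 + 12600 * X ^ 2 +
    40320 * X + 60480 : ℤ[X]).natDegree = 6 := by
  compute_degree!

theorem sextic_ne_zero_zmod : ∀ x : ZMod 49, x ^ 6 + 24 * x ^ 5 + 300 * x ^ 4 + 2400 * x ^ 3 +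
    12600 * x ^ 2 + 40320 * x + 60480 ≠ 0 := by
  decide

theorem irreducible_sextic : Irreducible (X ^ 6 + 24 * X ^ 5 + 300 * X ^ 4 + 2400 * X ^ 3 +
    12600 * X ^ 2 + 40320 * X + 60480 : ℤ[X]) := by
  have hne : (X ^ 6 + 24 * X ^ 5 + 300 * X ^ 4 + 2400 * X ^ 3 + 12600 * X ^ 2 +
      40320 * X + 60480 : ℤ[X]) ≠ 1 := fun h => by
    simpa [natDegree_sextic] using congrArg natDegree h
  rw [monic_sextic.irreducible_iff_natDegree', and_iff_right hne, natDegree_sextic]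
  intro g h hg hh hgh hdeg
  rw [Finset.mem_Ioc] at hdeg
  have hsum : g.natDegree + h.natDegree = 6 := by
    rw [← hg.natDegree_mul hh, hgh, natDegree_sextic]
  have : Fact (Nat.Prime 5) := ⟨Nat.prime_five⟩
  have hdvd : X ^ 5 ∣ (g * h).map (Int.castRingHom (ZMod 5)) := by
    have h5 : (5 : (ZMod 5)[X]) = 0 := CharP.cast_eq_zero (ZMod 5)[X] 5
    refine ⟨X + 24, ?_⟩
    rw [hgh]
    simp only [Polynomial.map_add, Polynomial.map_mul, Polynomial.map_pow, map_X,
      Polynomial.map_ofNat]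
    linear_combination (60 * X ^ 4 + 480 * X ^ 3 + 2520 * X ^ 2 + 8064 * X + 12096) * h5
  have h0 : ¬ ((5 : ℕ) : ℤ) ^ 2 ∣ (g * h).coeff 0 := by
    rw [hgh, coeff_zero_eq_eval_zero]
    norm_num
  have hh1 : h.natDegree = 1 := by
    have := le_natDegree_or_of_X_pow_dvd_map hg hh hdvd h0
    omega
  have hroot : (g * h).eval (-h.coeff 0) = 0 := by
    rw [eval_mul, hh.eq_X_add_C hh1]
    simp
  rw [hgh] at hroot
  apply sextic_ne_zero_zmod ((-h.coeff 0 : ℤ) : ZMod 49)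
  simpa using congrArg (Int.cast : ℤ → ZMod 49) hroot

theorem stmt_12 :
    Irreducible (∑ j ∈ Finset.range (6 + 1),
      C (((Nat.factorial 6 / Nat.factorial j) * Nat.choose (6 + 3 - j) (6 - j) : ℕ) : ℚ) * X ^ j : ℚ[X]) := by
  convert (monic_sextic.irreducible_iff_irreducible_map_fraction_map (K := ℚ)).mp
    irreducible_sextic using 1
  simp [Finset.sum_range_succ, Nat.factorial, Nat.choose]
  ring
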